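/- arXiv:2208.04737 — 2 statements merged into one kernel-verified Lean document; each statement's English description precedes it below -/
import Mathlib

section
/- Let (V_1, V_2) be a pair of doubly twisted isometries on a Hilbert space H with respect to a twist U. Then H decomposes as an orthogonal direct sum of four subspaces H_{uu} ⊕ H_{us} ⊕ H_{su} ⊕ H_{ss}, each reducing both V_1 and V_2, such that V_1 restricted to H_{uu}, H_{us} is unitary and to H_{su}, H_{ss} is a shift, and V_2 restricted to H_{uu}, H_{su} is unitary and to H_{us}, H_{ss} is a shift. -/
open ContinuousLinearMap Filter

section StarMonoid

variable {R : Type*} [Monoid R] [StarMul R] {U V W : R}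

theorem commute_star_left (hU : U * star U = 1) (hU' : star U * U = 1) (h : Commute U V) :
    Commute (star U) V := by
  calc star U * V = star U * (V * U) * star U := by simp only [mul_assoc, hU, mul_one]
    _ = (star U * U) * V * star U := by rw [← h.eq]; simp only [mul_assoc]
    _ = V * star U := by rw [hU', one_mul]

theorem commute_star_right (hU : U * star U = 1) (hU' : star U * U = 1) (h : Commute U V) :
    Commute U (star V) := by
  simpa using (commute_star_left hU hU' h).star_star

theorem star_mul_star_of_twisted (hU : U * star U = 1) (hU' : star U * U = 1) (hV : Commute U V)
    (hW : Commute U W) (h : V * W = U * (W * V)) :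
    star V * star W = U * (star W * star V) := by
  have h₁ : star W * star V = star V * star W * star U := by simpa using congr(star $h)
  rw [h₁, ← mul_assoc,
    ((commute_star_right hU hU' hV).mul_right (commute_star_right hU hU' hW)).eq,
    mul_assoc, hU, mul_one]

end StarMonoid

section Wold

variable {H : Type*} [NormedAddCommGroup H] [InnerProductSpace ℂ H]

/-- The closure of the space of vectors annihilated by some power of `A`. For `A = V*` with `V` an
isometry, this is the shift part in the Wold decomposition of `V`. -/
def closedNilspace (A : H →L[ℂ] H) : Submodule ℂ H :=
  (⨆ n : ℕ, (A ^ n).ker).topologicalClosure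

theorem mem_iSup_ker_pow {A : H →L[ℂ] H} {x : H} :
    x ∈ ⨆ n : ℕ, (A ^ n).ker ↔ ∃ n : ℕ, (A ^ n) x = 0 := by
  have hmono : Monotone fun n : ℕ => (A ^ n).ker := by
    refine monotone_nat_of_le_succ fun n x hx => ?_
    have hx' : (A ^ n) x = 0 := hx
    change (A ^ (n + 1)) x = 0
    rw [pow_succ', mul_apply_eq_comp, hx', map_zero]
  rw [Submodule.mem_iSup_of_directed _ hmono.directed_le]
  rfl

theorem ker_le_closedNilspace {A : H →L[ℂ] H} {x : H} (hx : A x = 0) : x ∈ closedNilspace A :=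
  Submodule.le_topologicalClosure _ (mem_iSup_ker_pow.2 ⟨1, by simpa using hx⟩)

theorem isClosed_closedNilspace (A : H →L[ℂ] H) : IsClosed (closedNilspace A : Set H) :=
  Submodule.isClosed_topologicalClosure _

/-- A bounded operator preserving the vectors annihilated by powers of `A` preserves their
closure. -/
theorem map_mem_closedNilspace {A T : H →L[ℂ] H}
    (hT : ∀ (n : ℕ) (x : H), (A ^ n) x = 0 → ∃ m : ℕ, (A ^ m) (T x) = 0)
    {x : H} (hx : x ∈ closedNilspace A) : T x ∈ closedNilspace A := by
  refine map_mem_closure T.continuous hx fun y hy => ?_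
  obtain ⟨n, hn⟩ := mem_iSup_ker_pow.1 hy
  exact mem_iSup_ker_pow.2 (hT n y hn)

theorem map_mem_closedNilspace_of_twisted {A T W : H →L[ℂ] H} (h : A * T = W * (T * A))
    (hW : Commute A W) {x : H} (hx : x ∈ closedNilspace A) : T x ∈ closedNilspace A := by
  refine map_mem_closedNilspace (fun n => ?_) hx
  suffices ∀ x, (A ^ n) x = 0 → (A ^ n) (T x) = 0 from fun x hx => ⟨n, this x hx⟩
  induction n with
  | zero => intro x hx; simp_all
  | succ n ih =>
    intro x hx
    rw [pow_succ, mul_apply_eq_comp] at hx ⊢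
    have h₁ : A (T x) = W (T (A x)) := congr($h x)
    have h₂ : (A ^ n) (W (T (A x))) = W ((A ^ n) (T (A x))) := congr($(hW.pow_left n) (T (A x)))
    rw [h₁, h₂, ih _ hx, map_zero]

theorem map_mem_closedNilspace_of_leftInverse {A V : H →L[ℂ] H} (h : A * V = 1)
    {x : H} (hx : x ∈ closedNilspace A) : V x ∈ closedNilspace A := by
  refine map_mem_closedNilspace (fun n x hx => ⟨n + 1, ?_⟩) hx
  have h₁ : A (V x) = x := congr($h x)
  rw [pow_succ, mul_apply_eq_comp, h₁, hx]

theorem tendsto_pow_of_mem_closedNilspace {A : H →L[ℂ] H} (hA : ‖A‖ ≤ 1) {x : H}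
    (hx : x ∈ closedNilspace A) : Tendsto (fun n : ℕ => (A ^ n) x) atTop (nhds 0) := by
  have hpow (n : ℕ) (z : H) : ‖(A ^ n) z‖ ≤ ‖z‖ := by
    induction n with
    | zero => simp
    | succ n ih =>
      rw [pow_succ', mul_apply_eq_comp]
      exact (A.le_of_opNorm_le hA _).trans (by simpa using ih)
  rw [Metric.tendsto_atTop]
  intro ε hε
  obtain ⟨y, hy, hxy⟩ := Metric.mem_closure_iff.1 hx ε hε
  obtain ⟨N, hN⟩ := mem_iSup_ker_pow.1 hy
  refine ⟨N, fun n hn => ?_⟩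
  have hy' : (A ^ n) y = 0 := by
    rw [← Nat.sub_add_cancel hn, pow_add, mul_apply_eq_comp, hN, map_zero]
  rw [dist_zero_right]
  calc ‖(A ^ n) x‖ = ‖(A ^ n) (x - y)‖ := by rw [map_sub, hy', sub_zero]
    _ ≤ ‖x - y‖ := hpow n _
    _ < ε := by rwa [← dist_eq_norm]

variable [CompleteSpace H]

theorem map_mem_orthogonal_of_adjoint {M : Submodule ℂ H} {T : H →L[ℂ] H}
    (hT : ∀ x ∈ M, adjoint T x ∈ M) {x : H} (hx : x ∈ Mᗮ) : T x ∈ Mᗮ := by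
  rw [Submodule.mem_orthogonal] at hx ⊢
  intro u hu
  rw [← adjoint_inner_left]
  exact hx _ (hT u hu)

/-- The operator `T` and its adjoint leave `M` invariant. -/
def Reduces (M : Submodule ℂ H) (T : H →L[ℂ] H) : Prop :=
  ∀ x ∈ M, T x ∈ M ∧ adjoint T x ∈ M

theorem Reduces.orthogonal {M : Submodule ℂ H} {T : H →L[ℂ] H} (h : Reduces M T) :
    Reduces Mᗮ T := fun _ hx =>
  ⟨map_mem_orthogonal_of_adjoint (fun y hy => (h y hy).2) hx,
    map_mem_orthogonal_of_adjoint (fun y hy => by simpa using (h y hy).1) hx⟩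

theorem Reduces.inf {M N : Submodule ℂ H} {T : H →L[ℂ] H} (hM : Reduces M T) (hN : Reduces N T) :
    Reduces (M ⊓ N) T := fun x hx =>
  ⟨⟨(hM x hx.1).1, (hN x hx.2).1⟩, ⟨(hM x hx.1).2, (hN x hx.2).2⟩⟩

theorem Reduces.commute_starProjection {M : Submodule ℂ H} [M.HasOrthogonalProjection]
    {T : H →L[ℂ] H} (h : Reduces M T) : Commute (adjoint T) M.starProjection := by
  ext x
  refine (Submodule.eq_starProjection_of_mem_orthogonal
    (h _ (M.starProjection_apply_mem x)).2 ?_).symm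
  change adjoint T x - adjoint T (M.starProjection x) ∈ Mᗮ
  rw [← map_sub]
  exact (h.orthogonal _ (M.sub_starProjection_mem_orthogonal x)).2

/-- An isometry maps a reducing subspace orthogonal to its shift part onto itself. -/
theorem Reduces.image_eq {M : Submodule ℂ H} {V : H →L[ℂ] H} (hV : adjoint V * V = 1)
    (h : Reduces M V) (hM : M ≤ (closedNilspace (adjoint V))ᗮ) : V '' (M : Set H) = M := by
  refine Set.Subset.antisymm (Set.image_subset_iff.2 fun x hx => (h x hx).1) fun x hx => ?_
  refine ⟨adjoint V x, (h x hx).2, ?_⟩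
  have hker : x - V (adjoint V x) ∈ closedNilspace (adjoint V) := by
    refine ker_le_closedNilspace ?_
    have h₁ : adjoint V (V (adjoint V x)) = adjoint V x := congr($hV (adjoint V x))
    rw [map_sub, h₁, sub_self]
  have hzero := Submodule.inner_right_of_mem_orthogonal hker
    (hM (M.sub_mem hx (h _ (h x hx).2).1))
  exact (sub_eq_zero.1 (inner_self_eq_zero.1 hzero)).symm

/-- The shift part of `V₁` reduces both members of a doubly twisted pair. -/
theorem reduces_closedNilspace_of_doublyTwisted {V₁ V₂ U : H →L[ℂ] H}
    (hV₁ : adjoint V₁ * V₁ = 1) (hU : U * adjoint U = 1) (hU' : adjoint U * U = 1)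
    (hUV₁ : Commute U V₁) (hUV₂ : Commute U V₂) (htw : V₁ * V₂ = U * (V₂ * V₁))
    (hdtw : adjoint V₁ * V₂ = adjoint U * (V₂ * adjoint V₁)) :
    Reduces (closedNilspace (adjoint V₁)) V₁ ∧ Reduces (closedNilspace (adjoint V₁)) V₂ := by
  rw [← star_eq_adjoint] at hU hU'
  have hUV₁' : Commute U (adjoint V₁) := commute_star_right hU hU' hUV₁
  have hUV₁'' : Commute (adjoint V₁) (adjoint U) := hUV₁.symm.star_star
  have htw' : adjoint V₁ * adjoint V₂ = U * (adjoint V₂ * adjoint V₁) :=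
    star_mul_star_of_twisted hU hU' hUV₁ hUV₂ htw
  refine ⟨fun x hx => ⟨map_mem_closedNilspace_of_leftInverse hV₁ hx, ?_⟩, fun x hx => ⟨?_, ?_⟩⟩
  · exact map_mem_closedNilspace_of_twisted (T := adjoint V₁) (W := 1)
      (one_mul (adjoint V₁ * adjoint V₁)).symm (Commute.one_right _) hx
  · exact map_mem_closedNilspace_of_twisted (T := V₂) hdtw hUV₁'' hx
  · exact map_mem_closedNilspace_of_twisted (T := adjoint V₂) htw' hUV₁'.symm hx

/-- If the projection onto `M` preserves `N`, then the intersections of `M`, `N` and their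
complements span the whole space. -/
theorem sup_inf_orthogonal_eq_top {M N : Submodule ℂ H} [M.HasOrthogonalProjection]
    [N.HasOrthogonalProjection] (h : ∀ x ∈ N, M.starProjection x ∈ N) :
    Mᗮ ⊓ Nᗮ ⊔ Mᗮ ⊓ N ⊔ M ⊓ Nᗮ ⊔ M ⊓ N = ⊤ := by
  have hself : adjoint M.starProjection = M.starProjection :=
    (isSelfAdjoint_starProjection M).adjoint_eq
  have h' (x : H) (hx : x ∈ Nᗮ) : M.starProjection x ∈ Nᗮ :=
    map_mem_orthogonal_of_adjoint (by rwa [hself]) hx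
  refine eq_top_iff.2 fun x _ => ?_
  set y := N.starProjection x
  have hy : y ∈ N := N.starProjection_apply_mem x
  have hz : x - y ∈ Nᗮ := N.sub_starProjection_mem_orthogonal x
  have hx : x = (((x - y) - M.starProjection (x - y)) + (y - M.starProjection y)
      + M.starProjection (x - y)) + M.starProjection y := by abel
  rw [hx]
  refine Submodule.add_mem_sup (Submodule.add_mem_sup (Submodule.add_mem_sup ?_ ?_) ?_) ?_
  · exact ⟨M.sub_starProjection_mem_orthogonal _, Nᗮ.sub_mem hz (h' _ hz)⟩
  · exact ⟨M.sub_starProjection_mem_orthogonal _, N.sub_mem hy (h _ hy)⟩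
  · exact ⟨M.starProjection_apply_mem _, h' _ hz⟩
  · exact ⟨M.starProjection_apply_mem _, h _ hy⟩

theorem adjoint_mul_self_eq_one {V : H →L[ℂ] H} (hV : ∀ h : H, ‖V h‖ = ‖h‖) :
    adjoint V * V = 1 :=
  V.norm_map_iff_adjoint_comp_self.1 hV

theorem norm_adjoint_le_one {V : H →L[ℂ] H} (hV : ∀ h : H, ‖V h‖ = ‖h‖) : ‖adjoint V‖ ≤ 1 := by
  rw [LinearIsometryEquiv.norm_map]
  exact V.opNorm_le_bound zero_le_one fun x => by rw [hV, one_mul]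

end Wold

/-- Wold-type (Słociński) decomposition for a pair of doubly twisted
isometries: `H` is the orthogonal direct sum of four subspaces reducing both `V₁` and `V₂`,
on which each `Vᵢ` restricts to a unitary or a shift as indicated. -/
theorem wold_doubly_twisted_isometries
    {H : Type*} [NormedAddCommGroup H] [InnerProductSpace ℂ H] [CompleteSpace H]
    (V₁ V₂ U : H →L[ℂ] H)
    (hV₁ : ∀ h : H, ‖V₁ h‖ = ‖h‖) (hV₂ : ∀ h : H, ‖V₂ h‖ = ‖h‖)
    (hU : adjoint U ∘L U = 1 ∧ U ∘L adjoint U = 1)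
    (hUV₁ : U ∘L V₁ = V₁ ∘L U) (hUV₂ : U ∘L V₂ = V₂ ∘L U)
    (htw : V₁ ∘L V₂ = U ∘L (V₂ ∘L V₁))
    (hdtw : adjoint V₁ ∘L V₂ = adjoint U ∘L (V₂ ∘L adjoint V₁)) :
    ∃ Huu Hus Hsu Hss : Submodule ℂ H,
      IsClosed (Huu : Set H) ∧ IsClosed (Hus : Set H) ∧
      IsClosed (Hsu : Set H) ∧ IsClosed (Hss : Set H) ∧
      -- pairwise orthogonal
      Huu ≤ Husᗮ ∧ Huu ≤ Hsuᗮ ∧ Huu ≤ Hssᗮ ∧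
      Hus ≤ Hsuᗮ ∧ Hus ≤ Hssᗮ ∧ Hsu ≤ Hssᗮ ∧
      -- they span H
      Huu ⊔ Hus ⊔ Hsu ⊔ Hss = ⊤ ∧
      -- each subspace reduces V₁ and V₂
      (∀ M ∈ [Huu, Hus, Hsu, Hss], ∀ x ∈ M,
        V₁ x ∈ M ∧ adjoint V₁ x ∈ M ∧ V₂ x ∈ M ∧ adjoint V₂ x ∈ M) ∧
      -- V₁ is unitary on Huu and Hus
      V₁ '' (Huu : Set H) = (Huu : Set H) ∧ V₁ '' (Hus : Set H) = (Hus : Set H) ∧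
      -- V₂ is unitary on Huu and Hsu
      V₂ '' (Huu : Set H) = (Huu : Set H) ∧ V₂ '' (Hsu : Set H) = (Hsu : Set H) ∧
      -- V₁ is a shift on Hsu and Hss
      (∀ h ∈ Hsu, Tendsto (fun n : ℕ => ((adjoint V₁) ^ n) h) atTop (nhds 0)) ∧
      (∀ h ∈ Hss, Tendsto (fun n : ℕ => ((adjoint V₁) ^ n) h) atTop (nhds 0)) ∧
      -- V₂ is a shift on Hus and Hss
      (∀ h ∈ Hus, Tendsto (fun n : ℕ => ((adjoint V₂) ^ n) h) atTop (nhds 0)) ∧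
      (∀ h ∈ Hss, Tendsto (fun n : ℕ => ((adjoint V₂) ^ n) h) atTop (nhds 0)) := by
  have hI₁ := adjoint_mul_self_eq_one hV₁
  have hI₂ := adjoint_mul_self_eq_one hV₂
  obtain ⟨hU₁, hU₂⟩ := hU
  obtain ⟨hR₁₁, hR₁₂⟩ := reduces_closedNilspace_of_doublyTwisted hI₁ hU₂ hU₁ hUV₁ hUV₂ htw hdtw
  have hcomm {V : H →L[ℂ] H} (h : Commute U V) : Commute (adjoint U) V :=
    commute_star_left (R := H →L[ℂ] H) hU₂ hU₁ h
  have htw' : V₂ * V₁ = adjoint U * (V₁ * V₂) := by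
    rw [show V₁ * V₂ = U * (V₂ * V₁) from htw, ← mul_assoc,
      show adjoint U * U = 1 from hU₁, one_mul]
  have hdtw' : adjoint V₂ * V₁ = adjoint (adjoint U) * (V₁ * adjoint V₂) := by
    have h₁ : adjoint V₂ * V₁ = V₁ * adjoint V₂ * U := by
      have h₂ := congrArg (star : (H →L[ℂ] H) → H →L[ℂ] H)
        (show star V₁ * V₂ = star U * (V₂ * star V₁) from hdtw)
      simpa only [star_mul, star_star, ← star_eq_adjoint] using h₂
    have h₃ : Commute U (V₁ * adjoint V₂) :=
      Commute.mul_right hUV₁ (commute_star_right (R := H →L[ℂ] H) hU₂ hU₁ hUV₂)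
    rw [h₁, adjoint_adjoint, h₃.eq]
  obtain ⟨hR₂₂, hR₂₁⟩ := reduces_closedNilspace_of_doublyTwisted hI₂
    (by rwa [adjoint_adjoint]) (by rwa [adjoint_adjoint]) (hcomm hUV₂) (hcomm hUV₁) htw' hdtw'
  set M := closedNilspace (adjoint V₁)
  set N := closedNilspace (adjoint V₂)
  have hMc : IsClosed (M : Set H) := isClosed_closedNilspace _
  have hNc : IsClosed (N : Set H) := isClosed_closedNilspace _
  have := hMc.completeSpace_coe
  have := hNc.completeSpace_coe
  have hMc' := M.isClosed_orthogonal
  have hNc' := N.isClosed_orthogonal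
  have hPN (x : H) (hx : x ∈ N) : M.starProjection x ∈ N :=
    map_mem_closedNilspace_of_twisted (W := 1)
      (hR₁₂.commute_starProjection.eq.trans (one_mul _).symm) (Commute.one_right _) hx
  have hreduce {P Q : Submodule ℂ H} (hP₁ : Reduces P V₁) (hP₂ : Reduces P V₂)
      (hQ₁ : Reduces Q V₁) (hQ₂ : Reduces Q V₂) (x : H) (hx : x ∈ P ⊓ Q) :
      V₁ x ∈ P ⊓ Q ∧ adjoint V₁ x ∈ P ⊓ Q ∧ V₂ x ∈ P ⊓ Q ∧ adjoint V₂ x ∈ P ⊓ Q :=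
    ⟨(hP₁.inf hQ₁ x hx).1, (hP₁.inf hQ₁ x hx).2, (hP₂.inf hQ₂ x hx).1, (hP₂.inf hQ₂ x hx).2⟩
  have horth {P Q P' Q' : Submodule ℂ H} (h : P ≤ P'ᗮ ∨ Q ≤ Q'ᗮ) : P ⊓ Q ≤ (P' ⊓ Q')ᗮ :=
    h.elim (fun h => inf_le_left.trans (h.trans (Submodule.orthogonal_le inf_le_left)))
      (fun h => inf_le_right.trans (h.trans (Submodule.orthogonal_le inf_le_right)))
  have hA₁ := norm_adjoint_le_one hV₁
  have hA₂ := norm_adjoint_le_one hV₂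
  refine ⟨Mᗮ ⊓ Nᗮ, Mᗮ ⊓ N, M ⊓ Nᗮ, M ⊓ N, hMc'.inter hNc', hMc'.inter hNc, hMc.inter hNc',
    hMc.inter hNc, horth (.inr le_rfl), horth (.inl le_rfl), horth (.inl le_rfl),
    horth (.inl le_rfl), horth (.inl le_rfl), horth (.inr le_rfl),
    sup_inf_orthogonal_eq_top hPN, ?_,
    (hR₁₁.orthogonal.inf hR₂₁.orthogonal).image_eq hI₁ inf_le_left,
    (hR₁₁.orthogonal.inf hR₂₁).image_eq hI₁ inf_le_left,
    (hR₁₂.orthogonal.inf hR₂₂.orthogonal).image_eq hI₂ inf_le_right,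
    (hR₁₂.inf hR₂₂.orthogonal).image_eq hI₂ inf_le_right,
    fun h hh => tendsto_pow_of_mem_closedNilspace hA₁ hh.1,
    fun h hh => tendsto_pow_of_mem_closedNilspace hA₁ hh.1,
    fun h hh => tendsto_pow_of_mem_closedNilspace hA₂ hh.2,
    fun h hh => tendsto_pow_of_mem_closedNilspace hA₂ hh.2⟩
  simp only [List.forall_mem_cons, List.not_mem_nil, false_imp_iff, implies_true, and_true]
  exact ⟨hreduce hR₁₁.orthogonal hR₁₂.orthogonal hR₂₁.orthogonal hR₂₂.orthogonal,
    hreduce hR₁₁.orthogonal hR₁₂.orthogonal hR₂₁ hR₂₂,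
    hreduce hR₁₁ hR₁₂ hR₂₁.orthogonal hR₂₂.orthogonal, hreduce hR₁₁ hR₁₂ hR₂₁ hR₂₂⟩
end

section
/- Let V, W be bounded operators on H with V an isometry, W a co-isometry, and U unitary, all satisfying UV = VU, UW = WU, VW = UWV. Then (W*V − UVW*)*(W*V − UVW*) = 0. -/
open ContinuousLinearMap

/-- For an isometry `V`, co-isometry `W` and unitary `U` with `UV = VU`,
`UW = WU` and `VW = UWV`, one has `(W*V − UVW*)*(W*V − UVW*) = 0`. -/
theorem defect_product_eq_zero
    {H : Type*} [NormedAddCommGroup H] [InnerProductSpace ℂ H] [CompleteSpace H]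
    (V W U : H →L[ℂ] H)
    (hV : adjoint V ∘L V = 1)
    (hW : W ∘L adjoint W = 1)
    (hU : adjoint U ∘L U = 1 ∧ U ∘L adjoint U = 1)
    (hUV : U ∘L V = V ∘L U) (hUW : U ∘L W = W ∘L U)
    (hVW : V ∘L W = U ∘L (W ∘L V)) :
    adjoint (adjoint W ∘L V - U ∘L (V ∘L adjoint W)) ∘L
      (adjoint W ∘L V - U ∘L (V ∘L adjoint W)) = 0 := by
  simp only [← star_eq_adjoint, ← mul_def] at *
  have cross : star V * W * (U * (V * star W)) = 1 := by
    calc star V * W * (U * (V * star W)) = star V * (W * U) * V * star W := by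
          simp only [mul_assoc]
      _ = star V * (U * (W * V)) * star W := by rw [← hUW]; simp only [mul_assoc]
      _ = (star V * V) * (W * star W) := by rw [← hVW]; simp only [mul_assoc]
      _ = 1 := by rw [hV, hW, one_mul]
  have cross_star : star (U * (V * star W)) * (star W * V) = 1 := by
    simpa only [star_mul, star_star, star_one, mul_assoc] using congrArg star cross
  have left_sq : star V * W * (star W * V) = 1 := by
    rw [mul_assoc, ← mul_assoc W, hW, one_mul, hV]
  have right_sq : star (U * (V * star W)) * (U * (V * star W)) = 1 := by
    calc star (U * (V * star W)) * (U * (V * star W))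
        = W * (star V * ((star U * U) * (V * star W))) := by
          simp only [star_mul, star_star, mul_assoc]
      _ = W * ((star V * V) * star W) := by rw [hU.1, one_mul, mul_assoc]
      _ = 1 := by rw [hV, one_mul, hW]
  rw [star_sub, sub_mul, mul_sub, mul_sub, cross_star, right_sq, star_mul, star_star,
    left_sq, cross, sub_self]
end
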